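/- Let α > 0, Γ > 0, a > 0, and let 0 < Λ < 1/3. Let x_s > 0 be the unique point with l(x_s) = Λ, where l(x) = α p(x)/(α + √Γ g(x)). Set A₁ = -(a/3)[x_s l'(x_s) + 3 l(x_s)] and A₂ = aΛ. Then A₁ < 0 and |A₁| < A₂. -/

import Mathlib

lemma pos_of_deriv_pos (f f' : ℝ → ℝ) (h0 : f 0 = 0) (hd : ∀ x, HasDerivAt f (f' x) x)
    (hpos : ∀ x, 0 < x → 0 < f' x) (x : ℝ) (hx : 0 < x) : 0 < f x := by
  have hm : StrictMonoOn f (Set.Ici 0) := by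
    apply strictMonoOn_of_deriv_pos (convex_Ici 0)
    · exact fun y _ => (hd y).continuousAt.continuousWithinAt
    · intro y hy
      rw [interior_Ici] at hy
      rw [(hd y).deriv]
      exact hpos y hy
  have := hm (Set.self_mem_Ici) (Set.mem_Ici.2 hx.le) hx
  rwa [h0] at this

lemma aux1 (x : ℝ) (hx : 0 < x) : 0 < x * Real.cosh x - Real.sinh x := by
  refine pos_of_deriv_pos (fun x => x * Real.cosh x - Real.sinh x) (fun x => x * Real.sinh x)
    (by simp) (fun y => ?_) (fun y hy => mul_pos hy (Real.sinh_pos_iff.2 hy)) x hx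
  refine HasDerivAt.congr_deriv (((hasDerivAt_id y).mul (Real.hasDerivAt_cosh y)).sub (Real.hasDerivAt_sinh y)) ?_
  simp

lemma aux2 (x : ℝ) (hx : 0 < x) : 0 < x * Real.sinh x - 2 * Real.cosh x + 2 := by
  refine pos_of_deriv_pos (fun x => x * Real.sinh x - 2 * Real.cosh x + 2)
    (fun x => x * Real.cosh x - Real.sinh x) (by simp) (fun y => ?_) aux1 x hx
  refine HasDerivAt.congr_deriv ((((hasDerivAt_id y).mul (Real.hasDerivAt_sinh y)).sub
    ((Real.hasDerivAt_cosh y).const_mul 2)).add_const 2) ?_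
  simp; ring

lemma aux3 (x : ℝ) (hx : 0 < x) : 0 < x * Real.cosh x - 3 * Real.sinh x + 2 * x := by
  refine pos_of_deriv_pos (fun x => x * Real.cosh x - 3 * Real.sinh x + 2 * x)
    (fun x => x * Real.sinh x - 2 * Real.cosh x + 2) (by simp) (fun y => ?_) aux2 x hx
  refine HasDerivAt.congr_deriv ((((hasDerivAt_id y).mul (Real.hasDerivAt_cosh y)).sub
    ((Real.hasDerivAt_sinh y).const_mul 3)).add ((hasDerivAt_id y).const_mul 2)) ?_
  simp; ring

lemma aux4 (x : ℝ) (hx : 0 < x) : 0 < x * Real.sinh x - 4 * Real.cosh x + x ^ 2 + 4 := by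
  refine pos_of_deriv_pos (fun x => x * Real.sinh x - 4 * Real.cosh x + x ^ 2 + 4)
    (fun x => x * Real.cosh x - 3 * Real.sinh x + 2 * x) (by simp) (fun y => ?_) aux3 x hx
  refine HasDerivAt.congr_deriv (((((hasDerivAt_id y).mul (Real.hasDerivAt_sinh y)).sub
    ((Real.hasDerivAt_cosh y).const_mul 4)).add ((hasDerivAt_id y).pow 2)).add_const 4) ?_
  simp; ring

lemma aux5 (x : ℝ) (hx : 0 < x) :
    0 < x * Real.cosh x * Real.sinh x - 2 * Real.sinh x ^ 2 + x ^ 2 := by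
  have h := aux4 (2 * x) (by linarith)
  rw [Real.sinh_two_mul, Real.cosh_two_mul] at h
  nlinarith [Real.cosh_sq x]

/-- Let `α > 0`, `Γ > 0`, `a > 0`, `0 < Λ < 1/3`, and let `x_s > 0` be the point with
`l(x_s) = Λ`. Set `A₁ = -(a/3)[x_s l'(x_s) + 3 l(x_s)]` and `A₂ = aΛ`. Then `A₁ < 0`
and `|A₁| < A₂`. -/
theorem coefficients (α Γ a Λ xs A₁ A₂ : ℝ) (hα : 0 < α) (hΓ : 0 < Γ) (ha : 0 < a)
    (hΛ : 0 < Λ ∧ Λ < 1 / 3) (hxs : 0 < xs)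
    (g p l : ℝ → ℝ)
    (hg : ∀ x, g x = Real.cosh x / Real.sinh x - 1 / x)
    (hp : ∀ x, p x = (x * (Real.cosh x / Real.sinh x) - 1) / x ^ 2)
    (hl : ∀ x, l x = α * p x / (α + Real.sqrt Γ * g x))
    (hroot : l xs = Λ)
    (hA₁ : A₁ = -(a / 3) * (xs * deriv l xs + 3 * l xs))
    (hA₂ : A₂ = a * Λ) :
    A₁ < 0 ∧ |A₁| < A₂ := by
  have hγ : 0 < Real.sqrt Γ := Real.sqrt_pos.2 hΓ
  set γ := Real.sqrt Γ
  have hs : 0 < Real.sinh xs := Real.sinh_pos_iff.2 hxs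
  have hsx : xs < Real.sinh xs := Real.self_lt_sinh_iff.2 hxs
  have hG : 0 < g xs := by
    have : g xs = (xs * Real.cosh xs - Real.sinh xs) / (xs * Real.sinh xs) := by
      rw [hg]; field_simp
    rw [this]
    exact div_pos (aux1 xs hxs) (mul_pos hxs hs)
  obtain ⟨G', hG'⟩ : ∃ G', G' = 1 / xs ^ 2 - 1 / Real.sinh xs ^ 2 := ⟨_, rfl⟩
  have hG'pos : 0 < G' := by
    rw [hG', sub_pos]
    exact one_div_lt_one_div_of_lt (by positivity) (by gcongr)
  have hGG : 0 < g xs - xs * G' := by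
    have : g xs - xs * G' = (xs * Real.cosh xs * Real.sinh xs - 2 * Real.sinh xs ^ 2 + xs ^ 2)
        / (xs * Real.sinh xs ^ 2) := by
      rw [hg, hG']; field_simp; ring
    rw [this]
    exact div_pos (aux5 xs hxs) (by positivity)
  have hgd : HasDerivAt g G' xs := by
    have e : g = fun x => Real.cosh x / Real.sinh x - x⁻¹ := by
      funext x; rw [hg, one_div]
    rw [e]
    refine HasDerivAt.congr_deriv (((Real.hasDerivAt_cosh xs).div (Real.hasDerivAt_sinh xs) hs.ne').sub
      (hasDerivAt_inv hxs.ne')) ?_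
    rw [hG']
    have := Real.cosh_sq xs
    field_simp
    rw [this]; ring
  have hle : l = fun x => α * (g x / x) / (α + γ * g x) := by
    funext x
    rw [hl, hp, hg]
    rcases eq_or_ne x 0 with rfl | hx
    · simp
    · congr 2
      field_simp
  have hD : 0 < α + γ * g xs := by positivity
  have hld := (((hgd.div (hasDerivAt_id xs) hxs.ne').const_mul α).div
    ((hgd.const_mul γ).const_add α) hD.ne')
  have hder : deriv l xs = -(α * ((g xs - xs * G') * (α + γ * g xs) + xs * g xs * γ * G'))
      / (xs ^ 2 * (α + γ * g xs) ^ 2) := by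
    rw [hle]
    refine Eq.trans hld.deriv ?_
    simp
    field_simp
    ring
  have hneg : deriv l xs < 0 := by
    rw [hder]
    apply div_neg_of_neg_of_pos _ (by positivity)
    rw [neg_lt_zero]
    positivity
  have hpos : 0 < xs * deriv l xs + 3 * l xs := by
    have : xs * deriv l xs + 3 * l xs
        = α * (2 * g xs * (α + γ * g xs) + xs * G' * α) / (xs * (α + γ * g xs) ^ 2) := by
      rw [hder, hle]
      field_simp
      ring
    rw [this]
    positivity
  have h1 : A₁ < 0 := by
    rw [hA₁]
    have := mul_pos ha hpos
    linarith
  refine ⟨h1, ?_⟩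
  rw [abs_of_neg h1, hA₁, hA₂, ← hroot]
  have := mul_pos (mul_pos ha hxs) (neg_pos.2 hneg)
  linarith
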